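/- Let C be a triangulated category with a generator X and a morphism-faithful rank function ρ with ρ(id_X) = 1 and ρ integer-valued. Then every nonzero morphism f : ΣⁿX → X is an isomorphism; consequently the graded endomorphism ring of X is a graded skew-field and every exact triangle in C splits. -/

import Mathlib

open CategoryTheory CategoryTheory.Limits CategoryTheory.Pretriangulated

variable {C : Type*} [Category C] [Preadditive C] [HasZeroObject C]
  [HasShift C ℤ] [∀ n : ℤ, (CategoryTheory.shiftFunctor C n).Additive] [Pretriangulated C]
  [HasFiniteBiproducts C]

/-- A triangle one of whose three arrows is an isomorphism. -/
def HasIsoArrow (T : Triangle C) : Prop :=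
  IsIso T.mor₁ ∨ IsIso T.mor₂ ∨ IsIso T.mor₃

/-- A triangle is split if it is isomorphic to a (finite) direct sum of triangles each
having an isomorphism as one of its arrows. -/
def IsSplitTriangle (T : Triangle C) : Prop :=
  ∃ (n : ℕ) (Ts : Fin n → Triangle C)
    (φ : (⨁ fun i => (Ts i).obj₃) ⟶ (⨁ fun i => (Ts i).obj₁)⟦(1 : ℤ)⟧),
    (∀ i, HasIsoArrow (Ts i)) ∧
    (∀ i, biproduct.ι (fun i => (Ts i).obj₃) i ≫ φ =
      (Ts i).mor₃ ≫ (biproduct.ι (fun i => (Ts i).obj₁) i)⟦(1 : ℤ)⟧') ∧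
    Nonempty (T ≅ Triangle.mk (biproduct.map fun i => (Ts i).mor₁)
      (biproduct.map fun i => (Ts i).mor₂) φ)

/-- A thick-subcategory-style generation predicate: X generates C if the only subclass
of objects containing X and closed under isomorphisms, shifts, extensions and retracts
is the class of all objects. -/
def GeneratesThickly (X : C) : Prop :=
  ∀ S : Set C,
    (∀ A B : C, (A ≅ B) → A ∈ S → B ∈ S) →
    (∀ A : C, A ∈ S → (A⟦(1 : ℤ)⟧ ∈ S ∧ A⟦(-1 : ℤ)⟧ ∈ S)) →
    (∀ T ∈ distTriang C, T.obj₁ ∈ S → T.obj₂ ∈ S → T.obj₃ ∈ S) →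
    (∀ (A B : C) (r : A ⟶ B) (s : B ⟶ A), s ≫ r = 𝟙 B → A ∈ S → B ∈ S) →
    X ∈ S → ∀ A : C, A ∈ S

open scoped ZeroObject

set_option linter.unusedSectionVars false

section TriangleIso

/-- Constructor for isomorphisms between triangles given by their three morphisms. -/
def triangleMkIso {A B Z A' B' Z' : C} {f : A ⟶ B} {g : B ⟶ Z} {h : Z ⟶ A⟦(1 : ℤ)⟧}
    {f' : A' ⟶ B'} {g' : B' ⟶ Z'} {h' : Z' ⟶ A'⟦(1 : ℤ)⟧}
    (e₁ : A ≅ A') (e₂ : B ≅ B') (e₃ : Z ≅ Z') (comm₁ : f ≫ e₂.hom = e₁.hom ≫ f')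
    (comm₂ : g ≫ e₃.hom = e₂.hom ≫ g') (comm₃ : h ≫ e₁.hom⟦(1 : ℤ)⟧' = e₃.hom ≫ h') :
    Triangle.mk f g h ≅ Triangle.mk f' g' h' :=
  Triangle.isoMk _ _ e₁ e₂ e₃ comm₁ comm₂ comm₃

end TriangleIso

section Rank

variable (ρ : ∀ ⦃A B : C⦄, (A ⟶ B) → ℝ)

/-- A rank function takes the same value on the identities of isomorphic objects. -/
lemma rank_id_eq_of_iso (hM3 : ∀ T ∈ distTriang C, ρ T.mor₁ + ρ T.mor₂ = ρ (𝟙 T.obj₂))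
    {A B : C} (e : A ≅ B) : ρ (𝟙 A) = ρ (𝟙 B) := by
  have target : ρ e.hom = ρ (𝟙 B) := by
    have he : ρ e.hom + ρ (0 : B ⟶ 0) = ρ (𝟙 B) := hM3 (Triangle.mk e.hom (0 : B ⟶ 0) 0)
      (isomorphic_distinguished _ (contractible_distinguished A) _
        (triangleMkIso (Iso.refl A) e.symm (Iso.refl _) (by simp) (by simp) (by simp)))
    have hB : ρ (𝟙 B) + ρ (0 : B ⟶ 0) = ρ (𝟙 B) := hM3 _ (contractible_distinguished B)
    linarith
  have source : ρ e.hom = ρ (𝟙 A) := by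
    have he : ρ (0 : 0 ⟶ A) + ρ e.hom = ρ (𝟙 A) := hM3 (Triangle.mk (0 : 0 ⟶ A) e.hom 0)
      (isomorphic_distinguished _ (contractible_distinguished₁ A) _
        (triangleMkIso (Iso.refl _) (Iso.refl A) e.symm (by simp) (by simp) (by simp)))
    have hA : ρ (0 : 0 ⟶ A) + ρ (𝟙 A) = ρ (𝟙 A) := hM3 _ (contractible_distinguished₁ A)
    linarith
  rw [← source, target]

/-- Every shift of an object has the same rank as the object. -/
lemma rank_id_shift (hM1 : ∀ ⦃A B : C⦄ (f : A ⟶ B), ρ (f⟦(1 : ℤ)⟧') = ρ f)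
    (hM3 : ∀ T ∈ distTriang C, ρ T.mor₁ + ρ T.mor₂ = ρ (𝟙 T.obj₂)) (X : C) (n : ℤ) :
    ρ (𝟙 (X⟦n⟧)) = ρ (𝟙 X) := by
  have step (m : ℤ) : ρ (𝟙 (X⟦m + 1⟧)) = ρ (𝟙 (X⟦m⟧)) := by
    rw [rank_id_eq_of_iso ρ hM3 ((shiftFunctorAdd C m 1).app X), ← hM1 (𝟙 (X⟦m⟧)),
      CategoryTheory.Functor.map_id]
    rfl
  induction n using Int.induction_on with
  | zero => exact rank_id_eq_of_iso ρ hM3 ((shiftFunctorZero C ℤ).app X)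
  | succ m ih => rw [step, ih]
  | pred m ih => rw [← ih, ← step, sub_add_cancel]

/-- An integral morphism-faithful rank function is at least one on nonzero morphisms. -/
lemma one_le_rank_of_ne_zero (hnonneg : ∀ ⦃A B : C⦄ (f : A ⟶ B), 0 ≤ ρ f)
    (hfaithful : ∀ ⦃A B : C⦄ (f : A ⟶ B), f ≠ 0 → ρ f ≠ 0)
    (hintegral : ∀ ⦃A B : C⦄ (f : A ⟶ B), ∃ m : ℤ, ρ f = (m : ℝ))
    {A B : C} (f : A ⟶ B) (hf : f ≠ 0) : 1 ≤ ρ f := by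
  obtain ⟨m, hm⟩ := hintegral f
  have h : 0 < ρ f := lt_of_le_of_ne (hnonneg f) (hfaithful f hf).symm
  rw [hm] at h ⊢
  exact_mod_cast h

/-- For an integral morphism-faithful rank function, a nonzero morphism out of an object of
rank one is a split monomorphism. -/
lemma exists_retraction_of_ne_zero (hnonneg : ∀ ⦃A B : C⦄ (f : A ⟶ B), 0 ≤ ρ f)
    (hM3 : ∀ T ∈ distTriang C, ρ T.mor₁ + ρ T.mor₂ = ρ (𝟙 T.obj₂))
    (hfaithful : ∀ ⦃A B : C⦄ (f : A ⟶ B), f ≠ 0 → ρ f ≠ 0)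
    (hintegral : ∀ ⦃A B : C⦄ (f : A ⟶ B), ∃ m : ℤ, ρ f = (m : ℝ))
    {Y B : C} (hY : ρ (𝟙 Y) = 1) (f : Y ⟶ B) (hf : f ≠ 0) : ∃ r : B ⟶ Y, f ≫ r = 𝟙 Y := by
  obtain ⟨W, h, δ, mem⟩ := distinguished_cocone_triangle₁ f
  have hsum : ρ h + ρ f = ρ (𝟙 Y) := hM3 _ mem
  have h0 : h = 0 := by
    by_contra hne
    linarith [one_le_rank_of_ne_zero ρ hnonneg hfaithful hintegral f hf,
      one_le_rank_of_ne_zero ρ hnonneg hfaithful hintegral h hne]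
  obtain ⟨r, hr⟩ : ∃ r : B ⟶ Y, 𝟙 Y = f ≫ r :=
    Triangle.yoneda_exact₂ _ mem (𝟙 Y) (by rw [h0]; exact zero_comp)
  exact ⟨r, hr.symm⟩

/-- For an integral morphism-faithful rank function, a nonzero morphism into an object of
rank one is a split epimorphism. -/
lemma exists_section_of_ne_zero (hnonneg : ∀ ⦃A B : C⦄ (f : A ⟶ B), 0 ≤ ρ f)
    (hM3 : ∀ T ∈ distTriang C, ρ T.mor₁ + ρ T.mor₂ = ρ (𝟙 T.obj₂))
    (hfaithful : ∀ ⦃A B : C⦄ (f : A ⟶ B), f ≠ 0 → ρ f ≠ 0)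
    (hintegral : ∀ ⦃A B : C⦄ (f : A ⟶ B), ∃ m : ℤ, ρ f = (m : ℝ))
    {A Y : C} (hY : ρ (𝟙 Y) = 1) (f : A ⟶ Y) (hf : f ≠ 0) : ∃ s : Y ⟶ A, s ≫ f = 𝟙 Y := by
  obtain ⟨W, h, δ, mem⟩ := distinguished_cocone_triangle f
  have hsum : ρ f + ρ h = ρ (𝟙 Y) := hM3 _ mem
  have h0 : h = 0 := by
    by_contra hne
    linarith [one_le_rank_of_ne_zero ρ hnonneg hfaithful hintegral f hf,
      one_le_rank_of_ne_zero ρ hnonneg hfaithful hintegral h hne]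
  obtain ⟨s, hs⟩ : ∃ s : Y ⟶ A, 𝟙 Y = s ≫ f :=
    Triangle.coyoneda_exact₂ _ mem (𝟙 Y) (by rw [h0]; exact comp_zero)
  exact ⟨s, hs.symm⟩

end Rank

section Generation

/-- If all morphisms from `A` to shifts of `B` vanish, so do all morphisms between shifts
of `A` and `B`. -/
lemma shift_hom_eq_zero {A B : C} (h : ∀ (n : ℤ) (f : A ⟶ B⟦n⟧), f = 0) (m n : ℤ)
    (f : A⟦m⟧ ⟶ B⟦n⟧) : f = 0 := by
  apply (shiftFunctor C (-m)).map_injective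
  rw [Functor.map_zero]
  have key := h (n + -m) ((shiftFunctorCompIsoId C m (-m) (by simp)).inv.app A ≫
    f⟦-m⟧' ≫ (shiftFunctorAdd C n (-m)).inv.app B)
  rw [← cancel_mono ((shiftFunctorAdd C n (-m)).inv.app B),
    ← cancel_epi ((shiftFunctorCompIsoId C m (-m) (by simp)).inv.app A)]
  simpa using key

/-- A nonzero object receives a nonzero morphism from a shift of a generator. -/
lemma GeneratesThickly.exists_hom_ne_zero {X : C} (hgen : GeneratesThickly X) {B : C}
    (hB : 𝟙 B ≠ 0) : ∃ (n : ℤ) (a : X⟦n⟧ ⟶ B), a ≠ 0 := by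
  by_contra! hzero
  have hall := hgen {A | ∀ (n : ℤ) (f : A ⟶ B⟦n⟧), f = 0} ?_ ?_ ?_ ?_ ?_ B
  · refine hB ?_
    have := hall 0 ((shiftFunctorZero C ℤ).inv.app B)
    rw [← cancel_mono ((shiftFunctorZero C ℤ).inv.app B)]
    simpa using this
  · intro A A' e hA n f
    rw [← cancel_epi e.hom, hA n (e.hom ≫ f), comp_zero]
  · exact fun A hA => ⟨fun n f => shift_hom_eq_zero hA 1 n f,
      fun n f => shift_hom_eq_zero hA (-1) n f⟩
  · intro T hT h₁ h₂ n f
    obtain ⟨g, rfl⟩ := Triangle.yoneda_exact₃ T hT f (h₂ n _)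
    rw [shift_hom_eq_zero h₁ 1 n g, comp_zero]
  · intro A A' r s hs hA n f
    rw [← Category.id_comp f, ← hs, Category.assoc, hA n (r ≫ f), comp_zero]
  · intro n f
    apply (shiftFunctor C (-n)).map_injective
    have key := hzero (-n) (f⟦-n⟧' ≫ (shiftFunctorCompIsoId C n (-n) (by simp)).hom.app B)
    rw [← cancel_mono ((shiftFunctorCompIsoId C n (-n) (by simp)).hom.app B), key]
    simp

end Generation

section Complement

/-- A split monomorphism with a chosen retraction has a complement compatible with it. -/
lemma exists_complement {Y A : C} (a : Y ⟶ A) (r : A ⟶ Y) (har : a ≫ r = 𝟙 Y) :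
    ∃ (K : C) (κ : A ⟶ K) (k : K ⟶ A),
      k ≫ κ = 𝟙 K ∧ a ≫ κ = 0 ∧ k ≫ r = 0 ∧ r ≫ a + κ ≫ k = 𝟙 A := by
  obtain ⟨K, κ, δ, mem⟩ := distinguished_cocone_triangle a
  have haκ : a ≫ κ = 0 := comp_distTriang_mor_zero₁₂ _ mem
  have hδ : δ = 0 := by
    have h : δ ≫ a⟦(1 : ℤ)⟧' = 0 := comp_distTriang_mor_zero₃₁ _ mem
    calc δ = δ ≫ (a ≫ r)⟦(1 : ℤ)⟧' := by rw [har, CategoryTheory.Functor.map_id,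
        Category.comp_id]
      _ = 0 := by rw [Functor.map_comp, reassoc_of% h, zero_comp]
  have : Epi κ := (Triangle.mor₃_eq_zero_iff_epi₂ _ mem).1 hδ
  have hra : a ≫ (𝟙 A - r ≫ a) = 0 := by simp [reassoc_of% har]
  obtain ⟨k, hk⟩ : ∃ k : K ⟶ A, 𝟙 A - r ≫ a = κ ≫ k := Triangle.yoneda_exact₂ _ mem _ hra
  refine ⟨K, κ, k, ?_, haκ, ?_, ?_⟩
  · rw [← cancel_epi κ, ← Category.assoc, ← hk]
    simp [haκ]
  · rw [← cancel_epi κ, ← Category.assoc, ← hk]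
    simp [har]
  · rw [← hk]; abel

/-- A direct sum decomposition, given by inclusions and projections, as an isomorphism. -/
noncomputable def biprodIsoOfComplement {Y A K : C} (a : Y ⟶ A) (r : A ⟶ Y) (κ : A ⟶ K) (k : K ⟶ A)
    (har : a ≫ r = 𝟙 Y) (hkκ : k ≫ κ = 𝟙 K) (haκ : a ≫ κ = 0) (hkr : k ≫ r = 0)
    (hsum : r ≫ a + κ ≫ k = 𝟙 A) : A ≅ Y ⊞ K where
  hom := biprod.lift r κ
  inv := biprod.desc a k
  hom_inv_id := by simpa using hsum
  inv_hom_id := by ext <;> simp [*]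

/-- A morphism which factors as a split epimorphism followed by a split monomorphism. -/
def HasSplitFactorization {A B : C} (f : A ⟶ B) : Prop :=
  ∃ (Q : C) (e : A ⟶ Q) (s : Q ⟶ A) (m : Q ⟶ B) (r : B ⟶ Q),
    s ≫ e = 𝟙 Q ∧ m ≫ r = 𝟙 Q ∧ f = e ≫ m

/-- If `f` followed by the projection onto a direct summand `Y` of its target is a split
epimorphism, and the complementary component of `f` factors as a split epimorphism followed
by a split monomorphism, then so does `f`. -/
lemma hasSplitFactorization_of_complement {Y A B K L P : C} {f : A ⟶ B} {a : Y ⟶ A} {t : B ⟶ Y}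
    {κ : A ⟶ K} {k : K ⟶ A} {q : B ⟶ L} {σ : L ⟶ B}
    (hft : a ≫ f ≫ t = 𝟙 Y) (hkκ : k ≫ κ = 𝟙 K) (haκ : a ≫ κ = 0) (hkt : k ≫ f ≫ t = 0)
    (hA : (f ≫ t) ≫ a + κ ≫ k = 𝟙 A)
    (hσq : σ ≫ q = 𝟙 L) (hcq : a ≫ f ≫ q = 0) (hσt : σ ≫ t = 0)
    (hB : t ≫ a ≫ f + q ≫ σ = 𝟙 B)
    {e : K ⟶ P} {s : P ⟶ K} {m : P ⟶ L} {r : L ⟶ P}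
    (hs : s ≫ e = 𝟙 P) (hr : m ≫ r = 𝟙 P) (hem : k ≫ f ≫ q = e ≫ m) :
    HasSplitFactorization f := by
  refine ⟨Y ⊞ P, biprod.lift (f ≫ t) (κ ≫ e), biprod.desc a (s ≫ k),
    biprod.desc (a ≫ f) (m ≫ σ), biprod.lift t (q ≫ r), ?_, ?_, ?_⟩
  · ext
    · simp [hft]
    · simp [reassoc_of% haκ]
    · simp [hkt]
    · simp [reassoc_of% hkκ, hs]
  · ext
    · simp [hft]
    · simp [reassoc_of% hcq]
    · simp [hσt]
    · simp [reassoc_of% hσq, hr]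
  · have hkf : k ≫ f = k ≫ f ≫ q ≫ σ := by
      calc k ≫ f = k ≫ f ≫ (t ≫ a ≫ f + q ≫ σ) := by rw [hB, Category.comp_id]
        _ = _ := by simp [reassoc_of% hkt]
    calc f = ((f ≫ t) ≫ a + κ ≫ k) ≫ f := by rw [hA, Category.id_comp]
      _ = f ≫ t ≫ a ≫ f + κ ≫ k ≫ f ≫ q ≫ σ := by
        rw [← hkf]; simp
      _ = _ := by
        simp [reassoc_of% hem]

end Complement

section Splitting

/-- The direct sum of a finite family of triangles. -/
noncomputable def biproductTriangle {n : ℕ} (Ts : Fin n → Triangle C) : Triangle C :=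
  Triangle.mk (biproduct.map fun i => (Ts i).mor₁) (biproduct.map fun i => (Ts i).mor₂)
    (biproduct.desc fun i => (Ts i).mor₃ ≫ (biproduct.ι (fun i => (Ts i).obj₁) i)⟦(1 : ℤ)⟧')

lemma biproductTriangle_distinguished {n : ℕ} (Ts : Fin n → Triangle C)
    (hTs : ∀ i, Ts i ∈ distTriang C) : biproductTriangle Ts ∈ distTriang C := by
  refine isomorphic_distinguished _ (productTriangle_distinguished Ts hTs) _
    (triangleMkIso (biproduct.isoProduct _) (biproduct.isoProduct _)
      (biproduct.isoProduct _) ?_ ?_ ?_)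
  · ext j
    simp
  · ext j
    simp
  · rw [← cancel_mono (piComparison (shiftFunctor C (1 : ℤ)) _)]
    ext i j
    by_cases hij : j = i
    · subst hij
      simp [← Functor.map_comp]
    · simp [← Functor.map_comp, biproduct.ι_π_ne _ hij, biproduct.ι_π_ne_assoc _ hij]

end Splitting

section Main

/-- Rank is additive along a direct sum decomposition. -/
lemma rank_id_eq_add_of_complement (ρ : ∀ ⦃A B : C⦄, (A ⟶ B) → ℝ)
    (hM2 : ∀ ⦃A B A' B' : C⦄ (f : A ⟶ B) (g : A' ⟶ B'), ρ (biprod.map f g) = ρ f + ρ g)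
    (hM3 : ∀ T ∈ distTriang C, ρ T.mor₁ + ρ T.mor₂ = ρ (𝟙 T.obj₂))
    {Y A K : C} (a : Y ⟶ A) (r : A ⟶ Y) (κ : A ⟶ K) (k : K ⟶ A)
    (har : a ≫ r = 𝟙 Y) (hkκ : k ≫ κ = 𝟙 K) (haκ : a ≫ κ = 0) (hkr : k ≫ r = 0)
    (hsum : r ≫ a + κ ≫ k = 𝟙 A) : ρ (𝟙 A) = ρ (𝟙 Y) + ρ (𝟙 K) := by
  rw [rank_id_eq_of_iso ρ hM3 (biprodIsoOfComplement a r κ k har hkκ haκ hkr hsum), ← hM2]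
  congr 1
  ext <;> simp

/-- Suppose that every nonzero object receives a nonzero morphism from some object of rank one,
and every nonzero morphism out of an object of rank one is a split monomorphism.
Then every morphism factors as a split epimorphism followed by a split monomorphism. -/
lemma hasSplitFactorization_of_rank (ρ : ∀ ⦃A B : C⦄, (A ⟶ B) → ℝ)
    (hnonneg : ∀ ⦃A B : C⦄ (f : A ⟶ B), 0 ≤ ρ f)
    (hM2 : ∀ ⦃A B A' B' : C⦄ (f : A ⟶ B) (g : A' ⟶ B'), ρ (biprod.map f g) = ρ f + ρ g)
    (hM3 : ∀ T ∈ distTriang C, ρ T.mor₁ + ρ T.mor₂ = ρ (𝟙 T.obj₂))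
    (hexists : ∀ A : C, 𝟙 A ≠ 0 → ∃ (Y : C) (a : Y ⟶ A), ρ (𝟙 Y) = 1 ∧ a ≠ 0)
    (hretract : ∀ ⦃Y B : C⦄ (f : Y ⟶ B), ρ (𝟙 Y) = 1 → f ≠ 0 → ∃ r : B ⟶ Y, f ≫ r = 𝟙 Y)
    {A B : C} (f : A ⟶ B) : HasSplitFactorization f := by
  obtain ⟨N, hN⟩ := exists_nat_gt (ρ (𝟙 A))
  induction N generalizing A B with
  | zero =>
    rw [Nat.cast_zero] at hN
    exact absurd (hnonneg _) hN.not_ge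
  | succ N ih =>
    push_cast at hN
    by_cases hA : 𝟙 A = 0
    · have hf : f = 0 := by rw [← Category.id_comp f, hA, zero_comp]
      exact ⟨0, 0, 0, 0, 0, (isZero_zero C).eq_of_src _ _, (isZero_zero C).eq_of_src _ _,
        by rw [hf, zero_comp]⟩
    · obtain ⟨Y, a, hY, ha⟩ := hexists A hA
      by_cases haf : a ≫ f = 0
      · obtain ⟨r, har⟩ := hretract a hY ha
        obtain ⟨K, κ, k, hkκ, haκ, hkr, hsum⟩ := exists_complement a r har
        have hrank := rank_id_eq_add_of_complement ρ hM2 hM3 a r κ k har hkκ haκ hkr hsum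
        obtain ⟨Q, e, s, m, t, hs, ht, hem⟩ := ih (k ≫ f) (by linarith)
        refine ⟨Q, κ ≫ e, s ≫ k, m, t, by simp [reassoc_of% hkκ, hs], ht, ?_⟩
        calc f = (r ≫ a + κ ≫ k) ≫ f := by rw [hsum, Category.id_comp]
          _ = (κ ≫ e) ≫ m := by simp [haf, hem]
      · obtain ⟨t, hat⟩ := hretract (a ≫ f) hY haf
        have hft : a ≫ f ≫ t = 𝟙 Y := by rw [← Category.assoc, hat]
        obtain ⟨K, κ, k, hkκ, haκ, hkt, hA'⟩ := exists_complement a (f ≫ t) hft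
        obtain ⟨L, q, σ, hσq, hcq, hσt, hB'⟩ := exists_complement (a ≫ f) t hat
        have hrank := rank_id_eq_add_of_complement ρ hM2 hM3 a _ κ k hft hkκ haκ hkt hA'
        obtain ⟨Q, e, s, m, r, hs, hr, hem⟩ := ih (k ≫ f ≫ q) (by linarith)
        exact hasSplitFactorization_of_complement hft hkκ haκ hkt hA' hσq
          (by rw [← Category.assoc, hcq]) hσt hB' hs hr hem

/-- The triangles `P ⟶ P ⟶ 0`, `K ⟶ 0 ⟶ K⟦1⟧` and `0 ⟶ L ⟶ L`. -/
noncomputable def elementaryTriangles (P K L : C) : Fin 3 → Triangle C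
  | 0 => Triangle.mk (𝟙 P) (0 : P ⟶ 0) 0
  | 1 => Triangle.mk (0 : K ⟶ 0) 0 (𝟙 (K⟦(1 : ℤ)⟧))
  | 2 => Triangle.mk (0 : 0 ⟶ L) (𝟙 L) 0

lemma elementaryTriangles_distinguished (P K L : C) (i : Fin 3) :
    elementaryTriangles P K L i ∈ distTriang C :=
  match i with
  | 0 => contractible_distinguished P
  | 1 => contractible_distinguished₂ K
  | 2 => contractible_distinguished₁ L

lemma hasIsoArrow_elementaryTriangles (P K L : C) (i : Fin 3) :
    HasIsoArrow (elementaryTriangles P K L i) :=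
  match i with
  | 0 => Or.inl (inferInstanceAs (IsIso (𝟙 P)))
  | 1 => Or.inr (Or.inr (inferInstanceAs (IsIso (𝟙 (K⟦(1 : ℤ)⟧)))))
  | 2 => Or.inr (Or.inl (inferInstanceAs (IsIso (𝟙 L))))

/-- A direct sum of three objects, given by its inclusions and projections. -/
noncomputable def isoBiproductFinThree {A : C} {F : Fin 3 → C} (p : ∀ i, A ⟶ F i)
    (ι : ∀ i, F i ⟶ A) (hι : ∀ i, ι i ≫ p i = 𝟙 (F i))
    (hne : ∀ i j, i ≠ j → ι i ≫ p j = 0)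
    (hsum : p 0 ≫ ι 0 + p 1 ≫ ι 1 + p 2 ≫ ι 2 = 𝟙 A) : A ≅ ⨁ F where
  hom := biproduct.lift p
  inv := biproduct.desc ι
  hom_inv_id := by rw [biproduct.lift_desc, Fin.sum_univ_three, hsum]
  inv_hom_id := by
    ext i j
    by_cases h : j = i
    · subst h
      simp [hι]
    · simp [hne j i h, biproduct.ι_π_ne _ h]

/-- A distinguished triangle whose first morphism factors as a split epimorphism followed by a
split monomorphism is split. -/
lemma isSplitTriangle_of_hasSplitFactorization (T : Triangle C) (hT : T ∈ distTriang C)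
    (h : HasSplitFactorization T.mor₁) : IsSplitTriangle T := by
  obtain ⟨P, e, s, m, r, hs, hr, hem⟩ := h
  obtain ⟨K, κ, k, hkκ, hsκ, hke, hA⟩ := exists_complement s e hs
  obtain ⟨L, q, σ, hσq, hmq, hσr, hB⟩ := exists_complement m r hr
  let pA : ∀ i, T.obj₁ ⟶ (elementaryTriangles P K L i).obj₁ :=
    fun | 0 => e | 1 => κ | 2 => (0 : T.obj₁ ⟶ 0)
  let pB : ∀ i, T.obj₂ ⟶ (elementaryTriangles P K L i).obj₂ :=
    fun | 0 => r | 1 => (0 : T.obj₂ ⟶ 0) | 2 => q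
  let eA : T.obj₁ ≅ ⨁ fun i => (elementaryTriangles P K L i).obj₁ :=
    isoBiproductFinThree pA
      (fun | 0 => s | 1 => k | 2 => (0 : 0 ⟶ T.obj₁))
      (fun | 0 => hs | 1 => hkκ | 2 => (isZero_zero C).eq_of_src _ _)
      (fun
        | 0, 0, h | 1, 1, h | 2, 2, h => absurd rfl h
        | 0, 1, _ => hsκ
        | 1, 0, _ => hke
        | 0, 2, _ | 1, 2, _ => comp_zero
        | 2, 0, _ | 2, 1, _ => zero_comp)
      (by
        change e ≫ s + κ ≫ k + (0 : T.obj₁ ⟶ 0) ≫ 0 = 𝟙 T.obj₁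
        rw [hA, zero_comp, add_zero])
  let eB : T.obj₂ ≅ ⨁ fun i => (elementaryTriangles P K L i).obj₂ :=
    isoBiproductFinThree pB
      (fun | 0 => m | 1 => (0 : 0 ⟶ T.obj₂) | 2 => σ)
      (fun | 0 => hr | 1 => (isZero_zero C).eq_of_src _ _ | 2 => hσq)
      (fun
        | 0, 0, h | 1, 1, h | 2, 2, h => absurd rfl h
        | 0, 2, _ => hmq
        | 2, 0, _ => hσr
        | 0, 1, _ | 2, 1, _ => comp_zero
        | 1, 0, _ | 1, 2, _ => zero_comp)
      (by
        change r ≫ m + (0 : T.obj₂ ⟶ 0) ≫ 0 + q ≫ σ = 𝟙 T.obj₂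
        rw [zero_comp, add_zero, hB])
  refine ⟨3, elementaryTriangles P K L, _, hasIsoArrow_elementaryTriangles P K L,
    fun i => biproduct.ι_desc _ i,
    ⟨isoTriangleOfIso₁₂ T (biproductTriangle (elementaryTriangles P K L)) hT
      (biproductTriangle_distinguished _ (elementaryTriangles_distinguished P K L)) eA eB ?_⟩⟩
  change T.mor₁ ≫ biproduct.lift pB = biproduct.lift pA ≫
    biproduct.map fun i => (elementaryTriangles P K L i).mor₁
  refine biproduct.hom_ext _ _ fun i => ?_
  rw [Category.assoc, Category.assoc, biproduct.lift_π, biproduct.map_π, biproduct.lift_π_assoc]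
  match i with
  | 0 =>
    change T.mor₁ ≫ r = e ≫ 𝟙 P
    rw [hem, Category.assoc, hr]
  | 1 => exact (isZero_zero C).eq_of_tgt _ _
  | 2 =>
    change T.mor₁ ≫ q = (0 : T.obj₁ ⟶ 0) ≫ (0 : 0 ⟶ L)
    rw [hem, Category.assoc, hmq, comp_zero, comp_zero]

end Main

/-- a triangulated category with a generator X and a morphism-faithful
integral rank function ρ with ρ(id X) = 1 is simple: every nonzero morphism
ΣⁿX ⟶ X is an isomorphism (so the graded endomorphism ring of X is a graded
skew-field), and every exact triangle splits. -/
theorem simple_of_morphism_faithful_prime_rank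
    [HasBinaryBiproducts C]
    (X : C) (hgen : GeneratesThickly X)
    (ρ : ∀ ⦃A B : C⦄, (A ⟶ B) → ℝ)
    (hnonneg : ∀ ⦃A B : C⦄ (f : A ⟶ B), 0 ≤ ρ f)
    (hM1 : ∀ ⦃A B : C⦄ (f : A ⟶ B), ρ (f⟦(1 : ℤ)⟧') = ρ f)
    (hM2 : ∀ ⦃A B A' B' : C⦄ (f : A ⟶ B) (g : A' ⟶ B'),
      ρ (biprod.map f g) = ρ f + ρ g)
    (hM3 : ∀ T ∈ distTriang C, ρ T.mor₁ + ρ T.mor₂ = ρ (𝟙 T.obj₂))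
    (hfaithful : ∀ ⦃A B : C⦄ (f : A ⟶ B), f ≠ 0 → ρ f ≠ 0)
    (hintegral : ∀ ⦃A B : C⦄ (f : A ⟶ B), ∃ m : ℤ, ρ f = (m : ℝ))
    (hprime : ρ (𝟙 X) = 1) :
    (∀ (n : ℤ) (f : X⟦n⟧ ⟶ X), f ≠ 0 → IsIso f) ∧
    (∀ T ∈ distTriang C, IsSplitTriangle T) := by
  have hrank (n : ℤ) : ρ (𝟙 (X⟦n⟧)) = 1 := (rank_id_shift ρ hM1 hM3 X n).trans hprime
  refine ⟨fun n f hf => ?_, fun T hT => isSplitTriangle_of_hasSplitFactorization T hT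
    (hasSplitFactorization_of_rank ρ hnonneg hM2 hM3 ?_ ?_ T.mor₁)⟩
  · obtain ⟨r, hr⟩ :=
      exists_retraction_of_ne_zero ρ hnonneg hM3 hfaithful hintegral (hrank n) f hf
    obtain ⟨s, hs⟩ :=
      exists_section_of_ne_zero ρ hnonneg hM3 hfaithful hintegral hprime f hf
    have : IsSplitMono f := ⟨⟨⟨r, hr⟩⟩⟩
    have : Epi f := (⟨⟨⟨s, hs⟩⟩⟩ : IsSplitEpi f).epi
    exact isIso_of_epi_of_isSplitMono f
  · intro A hA
    obtain ⟨n, a, ha⟩ := hgen.exists_hom_ne_zero hA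
    exact ⟨X⟦n⟧, a, hrank n, ha⟩
  · exact fun Y B f hY hf =>
      exists_retraction_of_ne_zero ρ hnonneg hM3 hfaithful hintegral hY f hf
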